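/- Let σ'(x) = e^x/(1+e^x)² denote the derivative of the logistic sigmoid. Let p ≥ 1 and let u ∈ ℝ^p satisfy u_i ≠ 0 for all i and |u_i| ≠ |u_j| for all i ≠ j. Then for every nonzero c ∈ ℝ^p and every a ∈ ℝ, there exists α ∈ ℝ such that Σ_{j=1}^{p} c_j · σ'(α·u_j) ≠ a. Equivalently, the function α ↦ Σ_j c_j σ'(α u_j) is not constant on ℝ. -/

import Mathlib

open Filter Topology

/-- The derivative of the sigmoid is even. -/
lemma exp_div_one_add_exp_sq_abs (x : ℝ) :
    Real.exp x / (1 + Real.exp x) ^ 2 = Real.exp (-|x|) / (1 + Real.exp (-|x|)) ^ 2 := by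
  have h : Real.exp x / (1 + Real.exp x) ^ 2 = Real.exp (-x) / (1 + Real.exp (-x)) ^ 2 := by
    rw [Real.exp_neg]
    have := Real.exp_pos x
    field_simp
    ring
  rcases abs_cases x with ⟨hx, -⟩ | ⟨hx, -⟩ <;> rw [hx]
  · exact h
  · rw [neg_neg]

lemma tendsto_exp_neg_mul_atTop {w : ℝ} (hw : 0 < w) :
    Tendsto (fun α : ℝ => Real.exp (-(α * w))) atTop (𝓝 0) :=
  Real.tendsto_exp_neg_atTop_nhds_zero.comp (tendsto_id.atTop_mul_const hw)

/-- The derivative of the sigmoid at `α * w`, rescaled by `exp (α * v)`, as `α → ∞`. -/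
lemma tendsto_exp_mul_sigmoid_deriv {v w : ℝ} (hw : w ≠ 0) (hv : v ≤ |w|) :
    Tendsto (fun α : ℝ => Real.exp (α * v) * (Real.exp (α * w) / (1 + Real.exp (α * w)) ^ 2))
      atTop (𝓝 (if v = |w| then 1 else 0)) := by
  have hden : Tendsto (fun α : ℝ => (1 + Real.exp (-(α * |w|))) ^ 2) atTop (𝓝 1) := by
    simpa using ((tendsto_exp_neg_mul_atTop (abs_pos.2 hw)).const_add 1).pow 2
  have hnum : Tendsto (fun α : ℝ => Real.exp (-(α * (|w| - v)))) atTop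
      (𝓝 (if v = |w| then 1 else 0)) := by
    split_ifs with h
    · simp [h]
    · exact tendsto_exp_neg_mul_atTop (sub_pos.2 (lt_of_le_of_ne hv h))
  have hdiv := hnum.div hden one_ne_zero
  rw [div_one] at hdiv
  refine hdiv.congr' ?_
  filter_upwards [eventually_ge_atTop 0] with α hα
  rw [exp_div_one_add_exp_sq_abs, abs_mul, abs_of_nonneg hα, ← mul_div_assoc, ← Real.exp_add,
    Pi.div_apply]
  ring_nf

/-- Auxiliary lemma for two-layer neural networks: if `u ∈ ℝ^p` has nonzero
entries with pairwise distinct absolute values, then for every nonzero `c` and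
every `a` there exists `α` with `Σⱼ cⱼ·σ'(α·uⱼ) ≠ a`, where
`σ'(x) = eˣ/(1+eˣ)²` is the derivative of the logistic sigmoid. -/
theorem sigmoid_deriv_combination_not_constant
    {p : ℕ} (hp : 1 ≤ p) (u : Fin p → ℝ)
    (hu : ∀ i, u i ≠ 0)
    (hdist : ∀ i j : Fin p, i ≠ j → |u i| ≠ |u j|) :
    ∀ c : Fin p → ℝ, c ≠ 0 → ∀ a : ℝ,
      ∃ α : ℝ,
        (∑ j, c j * (Real.exp (α * u j) / (1 + Real.exp (α * u j)) ^ 2)) ≠ a := by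
  intro c hc a
  by_contra! h
  have ha : a = 0 := by
    have hlim := tendsto_finsetSum Finset.univ fun j _ =>
      (tendsto_exp_mul_sigmoid_deriv (hu j) (abs_nonneg (u j))).const_mul (c j)
    have hne : ∀ j, (0 : ℝ) ≠ |u j| := fun j => (abs_pos.2 (hu j)).ne
    simp only [mul_zero, Real.exp_zero, one_mul, h, hne, if_false, Finset.sum_const_zero] at hlim
    exact tendsto_nhds_unique tendsto_const_nhds hlim
  subst ha
  obtain ⟨i, hi⟩ := Function.ne_iff.1 hc
  obtain ⟨k, hk, hmin⟩ := Finset.exists_min_image (Finset.univ.filter fun j => c j ≠ 0)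
    (fun j => |u j|) ⟨i, by simpa using hi⟩
  have hck : c k ≠ 0 := by simpa using hk
  have hlim : Tendsto (fun α : ℝ => ∑ j, c j * (Real.exp (α * |u k|) *
      (Real.exp (α * u j) / (1 + Real.exp (α * u j)) ^ 2))) atTop
      (𝓝 (∑ j, if j = k then c j else 0)) := by
    refine tendsto_finsetSum _ fun j _ => ?_
    by_cases hj : c j = 0
    · simp [hj]
    · convert (tendsto_exp_mul_sigmoid_deriv (hu j) (hmin j (by simpa using hj))).const_mul (c j)
        using 2
      by_cases hjk : j = k
      · simp [hjk]
      · simp [hjk, hdist k j (Ne.symm hjk)]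
  simp only [mul_left_comm (c _), ← Finset.mul_sum, h, mul_zero, Finset.sum_ite_eq',
    Finset.mem_univ, if_true] at hlim
  exact hck (tendsto_nhds_unique hlim tendsto_const_nhds)
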